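/- arXiv:1508.05408 — 3 statements merged into one kernel-verified Lean document; each statement's English description precedes it below -/
import Mathlib

section
/- If (u,m) is a smooth solution of the MFG system, then m(t,x) ≥ 0 for all (t,x) ∈ [0,T]×[0,L]. -/
open Set MeasureTheory intervalIntegral Function

noncomputable section

/-- Spatial derivative `u_x`. -/
def pdx (u : ℝ → ℝ → ℝ) (t x : ℝ) : ℝ := deriv (u t) x

/-- Second spatial derivative `u_xx`. -/
def pdxx (u : ℝ → ℝ → ℝ) (t x : ℝ) : ℝ := deriv (deriv (u t)) x

/-- Time derivative `u_t`. -/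
def pdt (u : ℝ → ℝ → ℝ) (t x : ℝ) : ℝ := deriv (fun s => u s x) t

/-- `η(t) = ∫₀^L m(t,x) dx`. -/
def mfgEta (L : ℝ) (m : ℝ → ℝ → ℝ) (t : ℝ) : ℝ := ∫ x in (0:ℝ)..L, m t x

/-- `f(t) = a(η(t)) + c(η(t)) p̄(t)`. -/
def mfgF (L ε : ℝ) (u m : ℝ → ℝ → ℝ) (t : ℝ) : ℝ :=
  2 / (2 + ε * mfgEta L m t)
    + (ε / (2 + ε * mfgEta L m t)) * ∫ x in (0:ℝ)..L, pdx u t x * m t x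

/-- `G(t,x) = (1/2)(f(t) − u_x(t,x))`. -/
def mfgG (L ε : ℝ) (u m : ℝ → ℝ → ℝ) (t x : ℝ) : ℝ :=
  (1/2) * (mfgF L ε u m t - pdx u t x)

/-- `H(t,x) = G(t,x)²`. -/
def mfgH (L ε : ℝ) (u m : ℝ → ℝ → ℝ) (t x : ℝ) : ℝ := (mfgG L ε u m t x)^2

/-- Standing assumptions on the data. -/
structure MFGData (T L σ r ε : ℝ) (uT m0 : ℝ → ℝ) : Prop where
  hT : 0 < T
  hL : 0 < L
  hσ : 0 < σ
  hr : 0 < r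
  hε : 0 ≤ ε
  uT_smooth : ContDiff ℝ 2 uT
  m0_smooth : ContDiff ℝ 2 m0
  uT_zero : uT 0 = 0
  uT_deriv_L : deriv uT L = 0
  uT_nonneg : ∀ x ∈ Icc (0:ℝ) L, 0 ≤ uT x
  uT_deriv_nonneg : ∀ x ∈ Icc (0:ℝ) L, 0 ≤ deriv uT x
  m0_zero : m0 0 = 0
  m0_L : m0 L = 0
  m0_deriv_L : deriv m0 L = 0
  m0_nonneg : ∀ x ∈ Icc (0:ℝ) L, 0 ≤ m0 x
  m0_mass : (∫ x in (0:ℝ)..L, m0 x) = 1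

/-- A smooth solution of the MFG system \eqref{main system}. -/
structure IsMFGSolution (T L σ r ε : ℝ) (uT m0 : ℝ → ℝ) (u m : ℝ → ℝ → ℝ) : Prop where
  u_smooth : ContDiff ℝ (⊤ : ℕ∞) (uncurry u)
  m_smooth : ContDiff ℝ (⊤ : ℕ∞) (uncurry m)
  hjb : ∀ t ∈ Ioo (0:ℝ) T, ∀ x ∈ Ioo (0:ℝ) L,
    pdt u t x + σ^2/2 * pdxx u t x - r * u t x + mfgH L ε u m t x = 0
  fp : ∀ t ∈ Ioo (0:ℝ) T, ∀ x ∈ Ioo (0:ℝ) L,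
    pdt m t x - σ^2/2 * pdxx m t x
      - deriv (fun y => mfgG L ε u m t y * m t y) x = 0
  m_init : ∀ x ∈ Icc (0:ℝ) L, m 0 x = m0 x
  u_term : ∀ x ∈ Icc (0:ℝ) L, u T x = uT x
  u_bdry : ∀ t ∈ Icc (0:ℝ) T, u t 0 = 0
  m_bdry : ∀ t ∈ Icc (0:ℝ) T, m t 0 = 0
  ux_bdry : ∀ t ∈ Icc (0:ℝ) T, pdx u t L = 0
  m_flux : ∀ t ∈ Icc (0:ℝ) T,
    σ^2/2 * pdx m t L + mfgG L ε u m t L * m t L = 0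

end

theorem ContDiff.uncurry_pdx {v : ℝ → ℝ → ℝ} (hv : ContDiff ℝ (⊤ : ℕ∞) (uncurry v)) :
    ContDiff ℝ (⊤ : ℕ∞) (uncurry (pdx v)) := by
  have h : uncurry (pdx v) = fun p : ℝ × ℝ => fderiv ℝ (uncurry v) p (0, 1) := by
    ext ⟨t, x⟩
    have h1 : HasFDerivAt (uncurry v) (fderiv ℝ (uncurry v) (t, x)) (t, x) :=
      (hv.differentiable (by simp) _).hasFDerivAt
    have h2 : HasDerivAt (fun y : ℝ => (t, y)) ((0 : ℝ), (1 : ℝ)) x :=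
      (hasDerivAt_const x t).prodMk (hasDerivAt_id x)
    exact (h1.comp_hasDerivAt x h2).deriv
  rw [h]
  exact (hv.fderiv_right (m := (⊤ : ℕ∞)) (by simp)).clm_apply contDiff_const

theorem ContDiff.uncurry_pdt {v : ℝ → ℝ → ℝ} (hv : ContDiff ℝ (⊤ : ℕ∞) (uncurry v)) :
    ContDiff ℝ (⊤ : ℕ∞) (uncurry (pdt v)) := by
  have h : uncurry (pdt v) = fun p : ℝ × ℝ => fderiv ℝ (uncurry v) p (1, 0) := by
    ext ⟨t, x⟩
    have h1 : HasFDerivAt (uncurry v) (fderiv ℝ (uncurry v) (t, x)) (t, x) :=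
      (hv.differentiable (by simp) _).hasFDerivAt
    have h2 : HasDerivAt (fun s : ℝ => (s, x)) ((1 : ℝ), (0 : ℝ)) t :=
      (hasDerivAt_id t).prodMk (hasDerivAt_const t x)
    exact (h1.comp_hasDerivAt t h2).deriv
  rw [h]
  exact (hv.fderiv_right (m := (⊤ : ℕ∞)) (by simp)).clm_apply contDiff_const

theorem hasDerivAt_pdx {v : ℝ → ℝ → ℝ} (hv : ContDiff ℝ (⊤ : ℕ∞) (uncurry v)) (t x : ℝ) :
    HasDerivAt (v t) (pdx v t x) x :=
  have h : ContDiff ℝ (⊤ : ℕ∞) (v t) := hv.comp (contDiff_const.prodMk contDiff_id)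
  (h.differentiable (by simp) x).hasDerivAt

theorem hasDerivAt_pdt {v : ℝ → ℝ → ℝ} (hv : ContDiff ℝ (⊤ : ℕ∞) (uncurry v)) (t x : ℝ) :
    HasDerivAt (fun s => v s x) (pdt v t x) t :=
  have h : ContDiff ℝ (⊤ : ℕ∞) (fun s => v s x) := hv.comp (contDiff_id.prodMk contDiff_const)
  (h.differentiable (by simp) t).hasDerivAt

/-- A function that is minimal at the right endpoint of an interval has nonpositive derivative
there. -/
theorem HasDerivAt.nonpos_of_forall_le_left {f : ℝ → ℝ} {f' a b : ℝ} (hf : HasDerivAt f f' b)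
    (hab : a < b) (hmin : ∀ s ∈ Icc a b, f b ≤ f s) : f' ≤ 0 := by
  have h := (hasDerivAt_iff_tendsto_slope.1 hf).mono_left
    (nhdsWithin_mono b (fun y (hy : y < b) => ne_of_lt hy) :
      nhdsWithin b (Iio b) ≤ nhdsWithin b {b}ᶜ)
  refine le_of_tendsto h ?_
  filter_upwards [Ioo_mem_nhdsLT hab] with s hs
  rw [slope_def_field]
  exact div_nonpos_of_nonneg_of_nonpos (sub_nonneg.2 (hmin s ⟨hs.1.le, hs.2.le⟩))
    (by linarith [hs.2])

/-- The second-order necessary condition at a local minimum. -/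
theorem IsLocalMin.deriv_deriv_nonneg {f : ℝ → ℝ} {x : ℝ} (h : IsLocalMin f x)
    (hc : ContinuousAt f x) : 0 ≤ deriv (deriv f) x := by
  by_contra! hneg
  have hmax := isLocalMax_of_deriv_deriv_neg hneg h.deriv_eq_zero hc
  have hconst : f =ᶠ[nhds x] fun _ => f x := by
    filter_upwards [h, hmax] with y h1 h2
    exact le_antisymm h2 h1
  have h2 := hconst.deriv.deriv_eq
  simp at h2
  linarith

/-- Minimum principle for a linear parabolic equation with bounded coefficients on
`[0, T) × [0, L]`, with Dirichlet condition on the left and Robin condition on the right. -/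
theorem parabolic_nonneg {T L a B C : ℝ} {m b c : ℝ → ℝ → ℝ} {β : ℝ → ℝ} (ha : 0 < a)
    (hL : 0 < L) (hm : ContDiff ℝ (⊤ : ℕ∞) (uncurry m))
    (hb : ∀ t ∈ Ioo 0 T, ∀ x ∈ Ioo 0 L, |b t x| ≤ B)
    (hc : ∀ t ∈ Ioo 0 T, ∀ x ∈ Ioo 0 L, c t x ≤ C)
    (hβ : ∀ t ∈ Ioo 0 T, |β t| ≤ B)
    (heq : ∀ t ∈ Ioo 0 T, ∀ x ∈ Ioo 0 L,
      pdt m t x = a * pdxx m t x + b t x * pdx m t x + c t x * m t x)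
    (hinit : ∀ x ∈ Icc 0 L, 0 ≤ m 0 x)
    (hleft : ∀ t ∈ Ioo 0 T, 0 ≤ m t 0)
    (hright : ∀ t ∈ Ioo 0 T, a * pdx m t L + β t * m t L = 0) :
    ∀ t ∈ Ico 0 T, ∀ x ∈ Icc 0 L, 0 ≤ m t x := by
  intro t₁ ht₁ x₁ hx₁
  by_contra! hneg
  obtain ⟨K, hK0, hK⟩ : ∃ K : ℝ, 0 < K ∧ B < a * K := by
    refine ⟨(|B| + 1) / a, by positivity, ?_⟩
    rw [mul_div_cancel₀ _ ha.ne']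
    linarith [le_abs_self B]
  obtain ⟨l, hl⟩ : ∃ l : ℝ, a * K ^ 2 + B * K + C < l := exists_gt _
  let e : ℝ → ℝ → ℝ := fun t x => Real.exp (-(l * t) - K * x)
  have he : ∀ t x, 0 < e t x := fun t x => Real.exp_pos _
  have hex : ∀ t x, HasDerivAt (e t) (-K * e t x) x := by
    intro t x
    have h : HasDerivAt (fun y : ℝ => -(l * t) - K * y) (-K) x := by
      simpa using ((hasDerivAt_id x).const_mul K).const_sub (-(l * t))
    simpa [e, mul_comm] using h.exp
  have het : ∀ t x, HasDerivAt (fun s => e s x) (-l * e t x) t := by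
    intro t x
    have h : HasDerivAt (fun s : ℝ => -(l * s) - K * x) (-l) t := by
      simpa using (((hasDerivAt_id t).const_mul l).neg).sub_const (K * x)
    simpa [e, mul_comm] using h.exp
  let w : ℝ → ℝ → ℝ := fun t x => m t x * e t x
  have hwx : ∀ t x, HasDerivAt (w t) ((pdx m t x - K * m t x) * e t x) x := by
    intro t x
    refine ((hasDerivAt_pdx hm t x).mul (hex t x)).congr_deriv ?_
    ring
  have hwt : ∀ t x, HasDerivAt (fun s => w s x) ((pdt m t x - l * m t x) * e t x) t := by
    intro t x
    refine ((hasDerivAt_pdt hm t x).mul (het t x)).congr_deriv ?_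
    ring
  have hwxx : ∀ t x, deriv (deriv (w t)) x
      = (pdxx m t x - 2 * K * pdx m t x + K ^ 2 * m t x) * e t x := by
    intro t x
    have h1 : deriv (w t) = fun y => (pdx m t y - K * m t y) * e t y :=
      funext fun y => (hwx t y).deriv
    have h2 : HasDerivAt (pdx m t) (pdxx m t x) x := hasDerivAt_pdx hm.uncurry_pdx t x
    rw [h1]
    refine (((h2.sub ((hasDerivAt_pdx hm t x).const_mul K)).mul (hex t x)).congr_deriv ?_).deriv
    simp only [Pi.sub_apply]
    ring
  have hwc : Continuous (uncurry w) := by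
    refine hm.continuous.mul (?_ : Continuous fun p : ℝ × ℝ => Real.exp (-(l * p.1) - K * p.2))
    fun_prop
  obtain ⟨⟨t₀, x₀⟩, ⟨ht₀, hx₀⟩, hmin⟩ :=
    (isCompact_Icc.prod isCompact_Icc : IsCompact (Icc 0 t₁ ×ˢ Icc 0 L)).exists_isMinOn
      ⟨(t₁, x₁), ⟨⟨ht₁.1, le_rfl⟩, hx₁⟩⟩ hwc.continuousOn
  have hle : ∀ t ∈ Icc 0 t₁, ∀ x ∈ Icc 0 L, w t₀ x₀ ≤ w t x := fun t ht x hx =>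
    hmin (show (t, x) ∈ Icc 0 t₁ ×ˢ Icc 0 L from ⟨ht, hx⟩)
  have hw0 : w t₀ x₀ < 0 :=
    (hle t₁ ⟨ht₁.1, le_rfl⟩ x₁ hx₁).trans_lt (mul_neg_of_neg_of_pos hneg (he _ _))
  have hm0 : m t₀ x₀ < 0 := by
    by_contra! h
    exact hw0.not_ge (mul_nonneg h (he _ _).le)
  have ht₀pos : 0 < t₀ := by
    refine lt_of_le_of_ne ht₀.1 fun h => ?_
    subst h
    exact hm0.not_ge (hinit x₀ hx₀)
  have ht₀' : t₀ ∈ Ioo 0 T := ⟨ht₀pos, ht₀.2.trans_lt ht₁.2⟩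
  have hx₀pos : 0 < x₀ := by
    refine lt_of_le_of_ne hx₀.1 fun h => ?_
    subst h
    exact hm0.not_ge (hleft t₀ ht₀')
  have hxder : (pdx m t₀ x₀ - K * m t₀ x₀) ≤ 0 := by
    refine nonpos_of_mul_nonpos_left ((hwx t₀ x₀).nonpos_of_forall_le_left hx₀pos ?_) (he t₀ x₀)
    exact fun y hy => hle t₀ ht₀ y ⟨hy.1, hy.2.trans hx₀.2⟩
  rcases hx₀.2.eq_or_lt with rfl | hx₀lt
  · have h1 := hright t₀ ht₀'
    have h2 := (abs_le.1 (hβ t₀ ht₀')).1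
    nlinarith [mul_nonneg ha.le (sub_nonneg.2 hxder)]
  have hx₀' : x₀ ∈ Ioo 0 L := ⟨hx₀pos, hx₀lt⟩
  have htder : pdt m t₀ x₀ - l * m t₀ x₀ ≤ 0 := by
    refine nonpos_of_mul_nonpos_left ((hwt t₀ x₀).nonpos_of_forall_le_left ht₀pos ?_) (he t₀ x₀)
    exact fun s hs => hle s ⟨hs.1, hs.2.trans ht₀.2⟩ x₀ hx₀
  have hloc : IsLocalMin (w t₀) x₀ := by
    filter_upwards [Icc_mem_nhds hx₀pos hx₀lt] with y hy using hle t₀ ht₀ y hy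
  have hxeq : pdx m t₀ x₀ = K * m t₀ x₀ := by
    have h := (hwx t₀ x₀).deriv ▸ hloc.deriv_eq_zero
    linarith [(mul_eq_zero.1 h).resolve_right (he t₀ x₀).ne']
  have hxxder := hloc.deriv_deriv_nonneg (hwx t₀ x₀).continuousAt
  rw [hwxx] at hxxder
  have hxx : 0 ≤ pdxx m t₀ x₀ - 2 * K * pdx m t₀ x₀ + K ^ 2 * m t₀ x₀ :=
    nonneg_of_mul_nonneg_left hxxder (he t₀ x₀)
  have hpde := heq t₀ ht₀' x₀ hx₀'
  rw [hxeq] at hxx hpde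
  have hbK : b t₀ x₀ * K ≤ B * K :=
    mul_le_mul_of_nonneg_right (abs_le.1 (hb t₀ ht₀' x₀ hx₀')).2 hK0.le
  have hcoef : 0 < l - a * K ^ 2 - b t₀ x₀ * K - c t₀ x₀ := by
    linarith [hc t₀ ht₀' x₀ hx₀']
  nlinarith [mul_neg_of_neg_of_pos hm0 hcoef, mul_nonneg ha.le hxx]

/-- The Hamilton-Jacobi-Bellman equation forces the coupling term `f` to be bounded. -/
theorem IsMFGSolution.exists_abs_mfgF_le {T L σ r ε : ℝ} {uT m0 : ℝ → ℝ} {u m : ℝ → ℝ → ℝ}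
    (hsol : IsMFGSolution T L σ r ε uT m0 u m) (hL : 0 < L) :
    ∃ F, ∀ t ∈ Ioo 0 T, |mfgF L ε u m t| ≤ F := by
  have hu := hsol.u_smooth
  have hcont : ∀ v : ℝ → ℝ → ℝ, ContDiff ℝ (⊤ : ℕ∞) (uncurry v) →
      Continuous fun t => v t (L / 2) := fun v hv =>
    hv.continuous.comp (by fun_prop : Continuous fun t : ℝ => (t, L / 2))
  have hxx : Continuous fun t => pdxx u t (L / 2) := hcont _ hu.uncurry_pdx.uncurry_pdx
  have ht := hcont _ hu.uncurry_pdt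
  have h0 := hcont _ hu
  obtain ⟨A, hA⟩ := (isCompact_Icc (a := (0 : ℝ)) (b := T)).exists_bound_of_continuousOn
    (hcont _ hu.uncurry_pdx).continuousOn
  obtain ⟨D, hD⟩ := (isCompact_Icc (a := (0 : ℝ)) (b := T)).exists_bound_of_continuousOn
    (f := fun t => pdt u t (L / 2) + σ ^ 2 / 2 * pdxx u t (L / 2) - r * u t (L / 2))
    (by fun_prop)
  refine ⟨A + 2 * (D + 1), fun t htT => ?_⟩
  have h1 := hsol.hjb t htT (L / 2) ⟨by linarith, by linarith⟩
  have h2 := hA t (Ioo_subset_Icc_self htT)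
  have h3 := hD t (Ioo_subset_Icc_self htT)
  rw [Real.norm_eq_abs, abs_le] at h2 h3
  have hG : mfgG L ε u m t (L / 2) ^ 2 ≤ D := by
    unfold mfgH at h1
    linarith
  have hf : mfgF L ε u m t = 2 * mfgG L ε u m t (L / 2) + pdx u t (L / 2) := by
    unfold mfgG
    ring
  rw [hf, abs_le]
  constructor <;>
    nlinarith [sq_nonneg (mfgG L ε u m t (L / 2) - 1), sq_nonneg (mfgG L ε u m t (L / 2) + 1)]

/-- If (u,m) is a smooth solution of the MFG system, then m(t,x) ≥ 0
for all (t,x) ∈ [0,T]×[0,L]. -/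
theorem mfg_m_nonneg (T L σ r ε : ℝ) (uT m0 : ℝ → ℝ)
    (hdata : MFGData T L σ r ε uT m0)
    (u m : ℝ → ℝ → ℝ) (hsol : IsMFGSolution T L σ r ε uT m0 u m) :
    ∀ t ∈ Icc (0:ℝ) T, ∀ x ∈ Icc (0:ℝ) L, 0 ≤ m t x := by
  have hL := hdata.hL
  have hu := hsol.u_smooth
  have hm := hsol.m_smooth
  obtain ⟨F, hF⟩ := hsol.exists_abs_mfgF_le hL
  have hrect : IsCompact (Icc 0 T ×ˢ Icc 0 L) := isCompact_Icc.prod isCompact_Icc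
  obtain ⟨A, hA⟩ := hrect.exists_bound_of_continuousOn hu.uncurry_pdx.continuous.continuousOn
  obtain ⟨C, hC⟩ :=
    hrect.exists_bound_of_continuousOn hu.uncurry_pdx.uncurry_pdx.continuous.continuousOn
  have hG : ∀ t ∈ Ioo 0 T, ∀ x ∈ Icc 0 L, |mfgG L ε u m t x| ≤ (F + A) / 2 := by
    intro t ht x hx
    have h1 := abs_le.1 (hF t ht)
    have h2 := abs_le.1 (hA (t, x) ⟨Ioo_subset_Icc_self ht, hx⟩)
    simp only [uncurry_apply_pair] at h2
    unfold mfgG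
    rw [abs_le]
    constructor <;> linarith
  have hpos : ∀ t ∈ Ico 0 T, ∀ x ∈ Icc 0 L, 0 ≤ m t x := by
    refine parabolic_nonneg (a := σ ^ 2 / 2) (b := mfgG L ε u m)
      (c := fun t x => -(1 / 2) * pdxx u t x) (β := fun t => mfgG L ε u m t L)
      (B := (F + A) / 2) (C := C / 2) (by have := hdata.hσ; positivity) hL hm
      (fun t ht x hx => hG t ht x (Ioo_subset_Icc_self hx)) ?_
      (fun t ht => hG t ht L ⟨hL.le, le_rfl⟩) ?_
      (fun x hx => (hsol.m_init x hx).symm ▸ hdata.m0_nonneg x hx)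
      (fun t ht => (hsol.m_bdry t (Ioo_subset_Icc_self ht)).ge)
      (fun t ht => hsol.m_flux t (Ioo_subset_Icc_self ht))
    · intro t ht x hx
      have h : |pdxx u t x| ≤ C := hC (t, x) ⟨Ioo_subset_Icc_self ht, Ioo_subset_Icc_self hx⟩
      linarith [(abs_le.1 h).1]
    · intro t ht x hx
      have h1 : HasDerivAt (mfgG L ε u m t) (1 / 2 * -pdxx u t x) x :=
        ((hasDerivAt_pdx hu.uncurry_pdx t x).const_sub (mfgF L ε u m t)).const_mul (1 / 2)
      have h2 : deriv (fun y => mfgG L ε u m t y * m t y) x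
          = 1 / 2 * -pdxx u t x * m t x + mfgG L ε u m t x * pdx m t x :=
        (h1.mul (hasDerivAt_pdx hm t x)).deriv
      have h3 := hsol.fp t ht x hx
      rw [h2] at h3
      linarith
  intro t ht x hx
  have hcont : Continuous fun s => m s x :=
    hm.continuous.comp (by fun_prop : Continuous fun s : ℝ => (s, x))
  have hclosed : IsClosed {s | 0 ≤ m s x} := isClosed_le continuous_const hcont
  have hsub : closure (Ico 0 T) ⊆ {s | 0 ≤ m s x} :=
    closure_minimal (fun s hs => hpos s hs x hx) hclosed
  rw [closure_Ico hdata.hT.ne] at hsub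
  exact hsub ht
end

section
/- If (u,m) is a smooth solution of the MFG system, then for every t ∈ [0,T] one has ∫₀^L m(t,x) dx ≤ ∫₀^L m₀(x) dx = 1; in particular 0 ≤ η(t) ≤ 1 for all t ∈ [0,T]. -/
open Set MeasureTheory intervalIntegral Function

open scoped Topology ContDiff

section PartialDerivatives

variable {w : ℝ → ℝ → ℝ}

theorem pdx_hasDerivAt (hw : ContDiff ℝ ∞ (uncurry w)) (t x : ℝ) :
    HasDerivAt (w t) (pdx w t x) x := by
  have h : Differentiable ℝ (fun y => uncurry w (t, y)) :=
    (hw.differentiable (by simp)).comp (by fun_prop)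
  exact (h x).hasDerivAt

theorem pdt_hasDerivAt (hw : ContDiff ℝ ∞ (uncurry w)) (t x : ℝ) :
    HasDerivAt (fun s => w s x) (pdt w t x) t := by
  have h : Differentiable ℝ (fun s => uncurry w (s, x)) :=
    (hw.differentiable (by simp)).comp (by fun_prop)
  exact (h t).hasDerivAt

theorem contDiff_uncurry_pdx (hw : ContDiff ℝ ∞ (uncurry w)) :
    ContDiff ℝ ∞ (uncurry (pdx w)) := by
  have h : uncurry (pdx w) = fun p => fderiv ℝ (uncurry w) p (0, 1) := by
    ext ⟨t, x⟩
    have h1 := (hw.differentiable (by simp) (t, x)).hasFDerivAt.comp_hasDerivAt x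
      ((hasDerivAt_const x t).prodMk (hasDerivAt_id x))
    exact (pdx_hasDerivAt hw t x).unique h1
  rw [h]
  exact (hw.fderiv_right (by simp)).clm_apply contDiff_const

theorem contDiff_uncurry_pdt (hw : ContDiff ℝ ∞ (uncurry w)) :
    ContDiff ℝ ∞ (uncurry (pdt w)) := by
  have h : uncurry (pdt w) = fun p => fderiv ℝ (uncurry w) p (1, 0) := by
    ext ⟨t, x⟩
    have h1 := (hw.differentiable (by simp) (t, x)).hasFDerivAt.comp_hasDerivAt t
      ((hasDerivAt_id t).prodMk (hasDerivAt_const t x))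
    exact (pdt_hasDerivAt hw t x).unique h1
  rw [h]
  exact (hw.fderiv_right (by simp)).clm_apply contDiff_const

end PartialDerivatives

/-- Differentiation under the integral sign for jointly continuous data. -/
theorem hasDerivAt_intervalIntegral_of_continuous {F F' : ℝ → ℝ → ℝ} (a b : ℝ)
    (hF : Continuous (uncurry F)) (hF' : Continuous (uncurry F'))
    (hd : ∀ t x, HasDerivAt (fun s => F s x) (F' t x) t) (t : ℝ) :
    HasDerivAt (fun s => ∫ x in a..b, F s x) (∫ x in a..b, F' t x) t := by
  have hc (s : ℝ) : Continuous (F s) := hF.comp (Continuous.prodMk_right s)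
  have hc' (s : ℝ) : Continuous (F' s) := hF'.comp (Continuous.prodMk_right s)
  obtain ⟨C, hC⟩ := (isCompact_Icc (a := t - 1) (b := t + 1)).prod
    (isCompact_uIcc (a := a) (b := b)) |>.exists_bound_of_continuousOn hF'.continuousOn
  refine (hasDerivAt_integral_of_dominated_loc_of_deriv_le (bound := fun _ => C)
    (Icc_mem_nhds (by linarith : t - 1 < t) (by linarith : t < t + 1))
    (Filter.Eventually.of_forall fun s => (hc s).aestronglyMeasurable)
    ((hc t).intervalIntegrable a b) (hc' t).aestronglyMeasurable
    (Filter.Eventually.of_forall fun x hx s hs => ?_) (by simp)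
    (Filter.Eventually.of_forall fun x _ s _ => hd s x)).2
  exact hC (s, x) ⟨hs, uIoc_subset_uIcc hx⟩

theorem hasDerivAt_min_zero_pow (n : ℕ) (y : ℝ) :
    HasDerivAt (fun z : ℝ => min z 0 ^ (n + 2)) ((n + 2) * min y 0 ^ (n + 1)) y := by
  rcases lt_trichotomy y 0 with hy | rfl | hy
  · have h := hasDerivAt_pow (n + 2) y
    rw [min_eq_left hy.le]
    refine HasDerivAt.congr_of_eventuallyEq (f := fun z : ℝ => z ^ (n + 2)) ?_ ?_
    · simpa using h
    · filter_upwards [Iio_mem_nhds hy] with z hz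
      rw [min_eq_left (le_of_lt hz)]
  · rw [hasDerivAt_iff_isLittleO_nhds_zero]
    have h1 : (fun h : ℝ => min (0 + h) 0 ^ (n + 2) - min 0 0 ^ (n + 2)
        - h • (((n : ℝ) + 2) * min 0 0 ^ (n + 1))) = fun h => min h 0 ^ (n + 2) := by
      ext h
      simp
    rw [h1]
    refine Asymptotics.IsBigO.trans_isLittleO (g := fun h : ℝ => h ^ (n + 2)) ?_ ?_
    · refine Asymptotics.IsBigO.of_bound 1 (Filter.Eventually.of_forall fun h => ?_)
      rw [norm_pow, norm_pow, one_mul]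
      refine pow_le_pow_left₀ (norm_nonneg _) ?_ _
      rcases le_total h 0 with hh | hh <;> simp [hh]
    · exact Asymptotics.isLittleO_pow_id (by omega)
  · rw [min_eq_right hy.le]
    refine HasDerivAt.congr_of_eventuallyEq (f := fun _ : ℝ => 0) ?_ ?_
    · simpa using hasDerivAt_const y (0 : ℝ)
    · filter_upwards [Ioi_mem_nhds hy] with z hz
      rw [min_eq_right (le_of_lt hz)]
      simp

/-- A nonnegative function vanishing at `a` with `φ' ≤ K φ` vanishes at `b`. -/
theorem eq_zero_of_deriv_le_mul {φ φ' : ℝ → ℝ} {a b K : ℝ} (hab : a ≤ b)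
    (hd : ∀ t, HasDerivAt φ (φ' t) t) (h0 : ∀ t, 0 ≤ φ t) (ha : φ a = 0)
    (hK : ∀ t ∈ Ioo a b, φ' t ≤ K * φ t) : φ b = 0 := by
  have hψ (t : ℝ) : HasDerivAt (fun s => Real.exp (-K * s) * φ s)
      (Real.exp (-K * t) * (-K * 1) * φ t + Real.exp (-K * t) * φ' t) t :=
    (((hasDerivAt_id t).const_mul (-K)).exp).mul (hd t)
  have hanti : AntitoneOn (fun s => Real.exp (-K * s) * φ s) (Icc a b) := by
    refine antitoneOn_of_deriv_nonpos (convex_Icc a b)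
      (fun t _ => (hψ t).continuousAt.continuousWithinAt)
      (fun t _ => (hψ t).differentiableAt.differentiableWithinAt) fun t ht => ?_
    rw [interior_Icc] at ht
    rw [(hψ t).deriv]
    nlinarith [hK t ht, Real.exp_pos (-K * t)]
  have h := hanti (left_mem_Icc.2 hab) (right_mem_Icc.2 hab) hab
  simp only [ha, mul_zero] at h
  exact le_antisymm (nonpos_of_mul_nonpos_right h (Real.exp_pos _)) (h0 b)

/-- A continuous nonnegative function with zero integral vanishes. -/
theorem eq_zero_of_intervalIntegral_eq_zero {g : ℝ → ℝ} {a b : ℝ} (hab : a < b)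
    (hg : Continuous g) (h0 : ∀ x, 0 ≤ g x) (hint : ∫ x in a..b, g x = 0) :
    ∀ x ∈ Icc a b, g x = 0 := by
  intro x hx
  by_contra hne
  have hpos : 0 < g x := lt_of_le_of_ne (h0 x) (Ne.symm hne)
  exact (intervalIntegral.integral_pos hab hg.continuousOn (fun y _ => h0 y)
    ⟨x, hx, hpos⟩).ne' hint

theorem neg_mul_flux_le {s B G n p : ℝ} (hs : 0 < s) (hB : G ^ 2 ≤ B) :
    -(12 * min n 0 ^ 2 * p * (s * p + G * n)) ≤ 3 * B / s * min n 0 ^ 4 := by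
  rcases le_total 0 n with hn | hn
  · simp [hn]
  · rw [min_eq_left hn]
    have h1 : 3 * B / s * n ^ 4 + 12 * n ^ 2 * p * (s * p + G * n)
        = 3 * n ^ 4 * (B - G ^ 2) / s + 12 * n ^ 2 * s * (p + G * n / (2 * s)) ^ 2 := by
      field_simp
      ring
    have h2 : 0 ≤ 3 * n ^ 4 * (B - G ^ 2) / s :=
      div_nonneg (mul_nonneg (by positivity) (sub_nonneg.2 hB)) hs.le
    have h3 : 0 ≤ 12 * n ^ 2 * s * (p + G * n / (2 * s)) ^ 2 := by positivity
    linarith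

section Solution

variable {T L σ r ε : ℝ} {uT m0 : ℝ → ℝ} {u m : ℝ → ℝ → ℝ}

theorem continuous_mfgEta (hm : Continuous (uncurry m)) : Continuous (mfgEta L m) :=
  continuous_parametric_intervalIntegral_of_continuous' hm 0 L

theorem continuousOn_mfgG (hu : ContDiff ℝ ∞ (uncurry u)) (hm : ContDiff ℝ ∞ (uncurry m))
    {I : Set ℝ} (hI : ∀ t ∈ I, 2 + ε * mfgEta L m t ≠ 0) :
    ContinuousOn (uncurry (mfgG L ε u m)) (I ×ˢ univ) := by
  have hux := (contDiff_uncurry_pdx hu).continuous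
  have hη : Continuous (mfgEta L m) := continuous_mfgEta hm.continuous
  have hp : Continuous fun t => ∫ x in (0:ℝ)..L, pdx u t x * m t x :=
    continuous_parametric_intervalIntegral_of_continuous' (hux.mul hm.continuous) 0 L
  have hden : Continuous fun t => 2 + ε * mfgEta L m t := by fun_prop
  have hf : ContinuousOn (mfgF L ε u m) I :=
    (continuousOn_const.div hden.continuousOn hI).add
      ((continuousOn_const.div hden.continuousOn hI).mul hp.continuousOn)
  exact continuousOn_const.mul
    ((hf.comp continuous_fst.continuousOn fun p hp => hp.1).sub hux.continuousOn)

theorem differentiable_mfgG (hu : ContDiff ℝ ∞ (uncurry u)) (t : ℝ) :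
    Differentiable ℝ (mfgG L ε u m t) := fun x =>
  (((pdx_hasDerivAt (contDiff_uncurry_pdx hu) t x).differentiableAt).const_sub _).const_mul _

/-- The probability flux `(σ²/2) m_x + G m`. -/
noncomputable def mfgFlux (L σ ε : ℝ) (u m : ℝ → ℝ → ℝ) (t x : ℝ) : ℝ :=
  σ ^ 2 / 2 * pdx m t x + mfgG L ε u m t x * m t x

variable (hsol : IsMFGSolution T L σ r ε uT m0 u m)

include hsol

theorem IsMFGSolution.differentiable_flux (t : ℝ) : Differentiable ℝ (mfgFlux L σ ε u m t) :=
  fun x => ((pdx_hasDerivAt (contDiff_uncurry_pdx hsol.m_smooth) t x).differentiableAt.const_mul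
    _).add ((differentiable_mfgG hsol.u_smooth t x).mul
      (pdx_hasDerivAt hsol.m_smooth t x).differentiableAt)

theorem IsMFGSolution.hasDerivAt_flux {t x : ℝ} (ht : t ∈ Ioo 0 T) (hx : x ∈ Ioo 0 L) :
    HasDerivAt (mfgFlux L σ ε u m t) (pdt m t x) x := by
  have h1 : HasDerivAt (fun y => σ ^ 2 / 2 * pdx m t y) (σ ^ 2 / 2 * pdxx m t x) x :=
    (pdx_hasDerivAt (contDiff_uncurry_pdx hsol.m_smooth) t x).const_mul _
  have h2 := ((differentiable_mfgG (L := L) (ε := ε) (m := m) hsol.u_smooth t x).mul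
    (pdx_hasDerivAt hsol.m_smooth t x).differentiableAt).hasDerivAt
  have h3 := hsol.fp t ht x hx
  have h4 : pdt m t x = σ ^ 2 / 2 * pdxx m t x
      + deriv (fun y => mfgG L ε u m t y * m t y) x := by linarith
  rw [h4]
  exact h1.add h2

theorem IsMFGSolution.hasDerivAt_negPart_energy (t : ℝ) :
    HasDerivAt (fun s => ∫ x in (0:ℝ)..L, min (m s x) 0 ^ 4)
      (∫ x in (0:ℝ)..L, 4 * min (m t x) 0 ^ 3 * pdt m t x) t := by
  have hm := hsol.m_smooth.continuous
  have hmt := (contDiff_uncurry_pdt hsol.m_smooth).continuous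
  have hmin : Continuous fun p : ℝ × ℝ => min (uncurry m p) 0 := hm.min continuous_const
  refine hasDerivAt_intervalIntegral_of_continuous
    (F := fun s x => min (m s x) 0 ^ 4)
    (F' := fun s x => 4 * min (m s x) 0 ^ 3 * pdt m s x) 0 L (by exact hmin.pow 4)
    (by exact (continuous_const.mul (hmin.pow 3)).mul hmt)
    (fun s x => ?_) t
  have h := (hasDerivAt_min_zero_pow 2 (m s x)).comp s (pdt_hasDerivAt hsol.m_smooth s x)
  norm_num at h
  exact h

theorem IsMFGSolution.negPart_energy_deriv_le (hL : 0 < L) (hσ : 0 < σ) {t B : ℝ}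
    (ht : t ∈ Ioo 0 T) (hB : ∀ x ∈ Icc 0 L, mfgG L ε u m t x ^ 2 ≤ B) :
    (∫ x in (0:ℝ)..L, 4 * min (m t x) 0 ^ 3 * pdt m t x)
      ≤ 3 * B / (σ ^ 2 / 2) * ∫ x in (0:ℝ)..L, min (m t x) 0 ^ 4 := by
  have htc : t ∈ Icc 0 T := Ioo_subset_Icc_self ht
  have hslice {w : ℝ → ℝ → ℝ} (hw : ContDiff ℝ ∞ (uncurry w)) : Continuous (w t) :=
    hw.continuous.comp (Continuous.prodMk_right t)
  have hmc : Continuous (m t) := hslice hsol.m_smooth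
  have hmx : Continuous (pdx m t) := hslice (contDiff_uncurry_pdx hsol.m_smooth)
  have hmt : Continuous (pdt m t) := hslice (contDiff_uncurry_pdt hsol.m_smooth)
  have hJ : Continuous (mfgFlux L σ ε u m t) := (hsol.differentiable_flux t).continuous
  have hmin : Continuous fun x => min (m t x) 0 := hmc.min continuous_const
  have hq (x : ℝ) : HasDerivAt (fun y => 4 * min (m t y) 0 ^ 3)
      (12 * min (m t x) 0 ^ 2 * pdx m t x) x := by
    have h := ((hasDerivAt_min_zero_pow 1 (m t x)).comp x
      (pdx_hasDerivAt hsol.m_smooth t x)).const_mul 4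
    refine h.congr_deriv ?_
    norm_num
    ring
  have hIBP := integral_mul_deriv_eq_deriv_mul_of_hasDerivAt (a := 0) (b := L)
    (u := fun y => 4 * min (m t y) 0 ^ 3) (v := mfgFlux L σ ε u m t)
    (u' := fun x => 12 * min (m t x) 0 ^ 2 * pdx m t x) (v' := pdt m t)
    (by fun_prop) hJ.continuousOn (fun x _ => hq x)
    (fun x hx => hsol.hasDerivAt_flux ht (by simpa [hL.le] using hx))
    (Continuous.intervalIntegrable (by fun_prop) _ _) (hmt.intervalIntegrable _ _)
  have hfluxL : mfgFlux L σ ε u m t L = 0 := hsol.m_flux t htc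
  rw [hIBP, hfluxL, hsol.m_bdry t htc, ← intervalIntegral.integral_const_mul]
  simp only [min_self, ne_eq, OfNat.ofNat_ne_zero, not_false_eq_true, zero_pow, mul_zero,
    zero_mul, sub_self, zero_sub]
  rw [← intervalIntegral.integral_neg]
  refine intervalIntegral.integral_mono_on hL.le
    (Continuous.intervalIntegrable (by fun_prop) _ _)
    (Continuous.intervalIntegrable (by fun_prop) _ _) fun x hx => ?_
  exact neg_mul_flux_le (by positivity) (hB x hx)

theorem IsMFGSolution.nonneg_of_negPart_energy_eq_zero (hL : 0 < L) {t : ℝ}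
    (h : ∫ x in (0:ℝ)..L, min (m t x) 0 ^ 4 = 0) : ∀ x ∈ Icc 0 L, 0 ≤ m t x := by
  intro x hx
  have hmc : Continuous (m t) := hsol.m_smooth.continuous.comp (Continuous.prodMk_right t)
  have h1 := eq_zero_of_intervalIntegral_eq_zero hL
    ((hmc.min continuous_const).pow 4) (fun y => Even.pow_nonneg (by decide) _) h x hx
  exact min_eq_right_iff.1 (pow_eq_zero_iff (by norm_num) |>.1 h1)

theorem IsMFGSolution.negPart_energy_eq_zero (hdata : MFGData T L σ r ε uT m0) :
    ∀ t ∈ Icc 0 T, ∫ x in (0:ℝ)..L, min (m t x) 0 ^ 4 = 0 := by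
  have hL := hdata.hL
  set φ : ℝ → ℝ := fun t => ∫ x in (0:ℝ)..L, min (m t x) 0 ^ 4 with hφ
  have hφd := hsol.hasDerivAt_negPart_energy
  have hφc : Continuous φ := continuous_iff_continuousAt.2 fun t => (hφd t).continuousAt
  have hφ0 (t : ℝ) : 0 ≤ φ t :=
    intervalIntegral.integral_nonneg hL.le fun x _ => by positivity
  refine IsClosed.Icc_subset_of_forall_exists_gt (s := {t | φ t = 0})
    ((isClosed_eq hφc continuous_const).inter isClosed_Icc) ?_ ?_
  · change (∫ x in (0:ℝ)..L, min (m 0 x) 0 ^ 4) = 0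
    rw [intervalIntegral.integral_congr (g := fun _ => 0)]
    · simp
    · intro x hx
      rw [uIcc_of_le hL.le] at hx
      simp [hsol.m_init x hx, hdata.m0_nonneg x hx]
  · rintro a ⟨ha, haI⟩ y hy
    have hη0 : 0 ≤ mfgEta L m a := intervalIntegral.integral_nonneg hL.le
      (hsol.nonneg_of_negPart_energy_eq_zero hL ha)
    have hηc : Continuous (mfgEta L m) := continuous_mfgEta hsol.m_smooth.continuous
    have hnhds : {t | 0 < 2 + ε * mfgEta L m t} ∈ 𝓝 a :=
      (isOpen_lt continuous_const (by fun_prop)).mem_nhds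
        (by have := mul_nonneg hdata.hε hη0; simp only [mem_ofPred_eq]; linarith)
    obtain ⟨δ, hδ, hball⟩ := Metric.mem_nhds_iff.1 hnhds
    let b := min (a + δ / 2) (min y T)
    have hab : a < b := lt_min (by linarith) (lt_min hy haI.2)
    have hbδ : b ≤ a + δ / 2 := min_le_left _ _
    have hby : b ≤ y := (min_le_right _ _).trans (min_le_left _ _)
    have hbT : b ≤ T := (min_le_right _ _).trans (min_le_right _ _)
    have hden : ∀ t ∈ Icc a b, 2 + ε * mfgEta L m t ≠ 0 := fun t ht => by
      refine (hball ?_ : 0 < 2 + ε * mfgEta L m t).ne'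
      rw [Metric.mem_ball, Real.dist_eq, abs_lt]
      constructor <;> linarith [ht.1, ht.2]
    obtain ⟨C, hC⟩ := ((isCompact_Icc (a := a) (b := b)).prod
      (isCompact_Icc (a := 0) (b := L))).exists_bound_of_continuousOn
      (((continuousOn_mfgG hsol.u_smooth hsol.m_smooth hden).mono
        (prod_mono_right (subset_univ _))).pow 2)
    refine ⟨b, eq_zero_of_deriv_le_mul hab.le hφd hφ0 ha fun t ht =>
      hsol.negPart_energy_deriv_le hL hdata.hσ (B := C)
        ⟨haI.1.trans_lt ht.1, ht.2.trans_le hbT⟩ fun x hx => ?_, hab, hby⟩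
    exact (le_abs_self _).trans (hC (t, x) ⟨Ioo_subset_Icc_self ht, hx⟩)

theorem IsMFGSolution.nonneg (hdata : MFGData T L σ r ε uT m0) :
    ∀ t ∈ Icc 0 T, ∀ x ∈ Icc 0 L, 0 ≤ m t x := fun t ht =>
  hsol.nonneg_of_negPart_energy_eq_zero hdata.hL (hsol.negPart_energy_eq_zero hdata t ht)

theorem IsMFGSolution.hasDerivAt_mfgEta (hL : 0 < L) {t : ℝ} (ht : t ∈ Ioo 0 T) :
    HasDerivAt (mfgEta L m) (-(σ ^ 2 / 2 * pdx m t 0)) t := by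
  have htc : t ∈ Icc 0 T := Ioo_subset_Icc_self ht
  have hmt := (contDiff_uncurry_pdt hsol.m_smooth).continuous
  have h := hasDerivAt_intervalIntegral_of_continuous 0 L hsol.m_smooth.continuous hmt
    (pdt_hasDerivAt hsol.m_smooth) t
  have hint := integral_eq_sub_of_hasDerivAt_of_le hL.le
    (hsol.differentiable_flux t).continuous.continuousOn
    (fun x hx => hsol.hasDerivAt_flux ht hx)
    ((hmt.comp (Continuous.prodMk_right t)).intervalIntegrable 0 L)
  have hfluxL : mfgFlux L σ ε u m t L = 0 := hsol.m_flux t htc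
  have hflux0 : mfgFlux L σ ε u m t 0 = σ ^ 2 / 2 * pdx m t 0 := by
    simp [mfgFlux, hsol.m_bdry t htc]
  rw [hfluxL, hflux0, zero_sub] at hint
  exact hint ▸ h

theorem IsMFGSolution.pdx_zero_nonneg (hdata : MFGData T L σ r ε uT m0) {t : ℝ}
    (ht : t ∈ Icc 0 T) : 0 ≤ pdx m t 0 := by
  have h := ((pdx_hasDerivAt hsol.m_smooth t 0).hasDerivWithinAt (s := Ioi 0))
  rw [hasDerivWithinAt_iff_tendsto_slope' self_notMem_Ioi] at h
  refine ge_of_tendsto h ?_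
  filter_upwards [Ioo_mem_nhdsGT hdata.hL] with x hx
  rw [slope_def_field, hsol.m_bdry t ht, sub_zero, sub_zero]
  exact div_nonneg (hsol.nonneg hdata t ht x (Ioo_subset_Icc_self hx)) hx.1.le

theorem IsMFGSolution.antitoneOn_mfgEta (hdata : MFGData T L σ r ε uT m0) :
    AntitoneOn (mfgEta L m) (Icc 0 T) := by
  refine antitoneOn_of_deriv_nonpos (convex_Icc 0 T)
    (continuous_mfgEta hsol.m_smooth.continuous).continuousOn
    (fun t ht => ?_) fun t ht => ?_ <;> rw [interior_Icc] at ht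
  · exact (hsol.hasDerivAt_mfgEta hdata.hL ht).differentiableAt.differentiableWithinAt
  · rw [(hsol.hasDerivAt_mfgEta hdata.hL ht).deriv]
    have := hsol.pdx_zero_nonneg hdata (Ioo_subset_Icc_self ht)
    exact neg_nonpos.2 (by positivity)

end Solution

/-- the total mass is nonincreasing: ∫₀^L m(t,x) dx ≤ ∫₀^L m₀ = 1,
in particular 0 ≤ η(t) ≤ 1. -/
theorem mfg_mass_decay (T L σ r ε : ℝ) (uT m0 : ℝ → ℝ)
    (hdata : MFGData T L σ r ε uT m0)
    (u m : ℝ → ℝ → ℝ) (hsol : IsMFGSolution T L σ r ε uT m0 u m) :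
    ∀ t ∈ Icc (0:ℝ) T,
      (∫ x in (0:ℝ)..L, m t x) ≤ (∫ x in (0:ℝ)..L, m0 x) ∧
      (∫ x in (0:ℝ)..L, m0 x) = 1 ∧
      0 ≤ mfgEta L m t ∧ mfgEta L m t ≤ 1 := by
  intro t ht
  have hη := hsol.antitoneOn_mfgEta hdata (left_mem_Icc.2 hdata.hT.le) ht ht.1
  have hinit : mfgEta L m 0 = ∫ x in (0:ℝ)..L, m0 x :=
    intervalIntegral.integral_congr fun x hx =>
      hsol.m_init x (by rwa [uIcc_of_le hdata.hL.le] at hx)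
  rw [hinit] at hη
  exact ⟨hη, hdata.m0_mass,
    intervalIntegral.integral_nonneg hdata.hL.le (hsol.nonneg hdata t ht),
    hη.trans_eq hdata.m0_mass⟩
end

section
/- Let k > 0 and let w be a smooth function on [0,T]×[0,L] satisfying −w_t − k w_xx ≤ 0 pointwise on (0,T)×(0,L) and w_x(t,L) = 0 for all t ∈ [0,T]. Then max over [0,T]×[0,L] of w equals max over Γ_T of w, where Γ_T = ([0,T]×{0}) ∪ ({T}×[0,L]); that is, w(t,x) ≤ max(sup_{s∈[0,T]} w(s,0), sup_{y∈[0,L]} w(T,y)) for all (t,x) ∈ [0,T]×[0,L]. -/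
open Set MeasureTheory intervalIntegral Function

/-- If `g` restricted to the segment from `a` to `b` is maximal at `a`, its derivative at `a` in the
direction of `b` is nonpositive. -/
theorem HasDerivAt.mul_sub_nonpos_of_forall_le {g : ℝ → ℝ} {g' a b : ℝ} (hg : HasDerivAt g g' a)
    (hmax : ∀ s ∈ segment ℝ a b, g s ≤ g a) : g' * (b - a) ≤ 0 := by
  have hloc : IsLocalMaxOn g (segment ℝ a b) a := IsMaxOn.localize hmax
  have h := hloc.hasFDerivWithinAt_nonpos hg.hasFDerivAt.hasFDerivWithinAt
    (sub_mem_posTangentConeAt_of_segment_subset subset_rfl)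
  simpa [mul_comm] using h

/-- The second derivative is nonpositive at a local maximum. -/
theorem IsLocalMax.deriv_deriv_nonpos {g : ℝ → ℝ} {a : ℝ} (hg : ContinuousAt g a)
    (hmax : IsLocalMax g a) : deriv (deriv g) a ≤ 0 := by
  by_contra! hpos
  have hmin := isLocalMin_of_deriv_deriv_pos hpos hmax.deriv_eq_zero hg
  have hconst : g =ᶠ[nhds a] fun _ => g a := by
    filter_upwards [hmax, hmin] with y h1 h2 using le_antisymm h1 h2
  have h := hconst.deriv.deriv_eq
  simp at h
  exact hpos.ne' h

/-- A maximum of `w t x + ε * (t - x)` over `[t₀,T] × [0,L]` lies on the half-boundary. -/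
theorem eq_zero_or_eq_of_perturbed_max {T L k t₀ ε : ℝ} (hL : 0 < L) (hk : 0 < k) (ht₀ : 0 < t₀)
    (hε : 0 < ε) {w : ℝ → ℝ → ℝ} (hw : ContDiff ℝ (⊤ : ℕ∞) (uncurry w))
    (hpde : ∀ t ∈ Ioo (0:ℝ) T, ∀ x ∈ Ioo (0:ℝ) L, -(pdt w t x) - k * pdxx w t x ≤ 0)
    (hbdry : ∀ t ∈ Icc (0:ℝ) T, pdx w t L = 0) {t x : ℝ} (ht : t ∈ Icc t₀ T) (hx : x ∈ Icc 0 L)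
    (hmax : ∀ s ∈ Icc t₀ T, ∀ y ∈ Icc 0 L, w s y + ε * (s - y) ≤ w t x + ε * (t - x)) :
    x = 0 ∨ t = T := by
  have hwx : Differentiable ℝ (w t) :=
    (hw.comp (contDiff_const.prodMk contDiff_id)).differentiable (by simp)
  have hwt : Differentiable ℝ (fun s => w s x) :=
    (hw.comp (contDiff_id.prodMk contDiff_const)).differentiable (by simp)
  have hdx (y : ℝ) : HasDerivAt (fun y => w t y + ε * (t - y)) (deriv (w t) y - ε) y := by
    simpa [sub_eq_add_neg] using
      (hwx y).hasDerivAt.fun_add (((hasDerivAt_id y).const_sub t).const_mul ε)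
  have hdt : HasDerivAt (fun s => w s x + ε * (s - x)) (pdt w t x + ε) t := by
    simpa [pdt] using (hwt t).hasDerivAt.fun_add (((hasDerivAt_id t).sub_const x).const_mul ε)
  by_contra! hne
  have hx0 : 0 < x := lt_of_le_of_ne hx.1 hne.1.symm
  have htT : t < T := lt_of_le_of_ne ht.2 hne.2
  rcases hx.2.eq_or_lt with rfl | hxL
  · have h := (hdx x).mul_sub_nonpos_of_forall_le (b := 0) fun y hy =>
      hmax t ht y ((convex_Icc 0 x).segment_subset hx ⟨le_rfl, hL.le⟩ hy)
    have hb : deriv (w t) x = 0 := hbdry t ⟨ht₀.le.trans ht.1, ht.2⟩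
    rw [hb] at h
    nlinarith [mul_pos hε hx0]
  · have h1 := hdt.mul_sub_nonpos_of_forall_le (b := T) fun s hs =>
      hmax s ((convex_Icc t₀ T).segment_subset ht ⟨ht.1.trans ht.2, le_rfl⟩ hs) x hx
    have h1' : pdt w t x + ε ≤ 0 := nonpos_of_mul_nonpos_left h1 (sub_pos.2 htT)
    have hloc : IsLocalMax (fun y => w t y + ε * (t - y)) x := by
      filter_upwards [Icc_mem_nhds hx0 hxL] with y hy using hmax t ht y hy
    have h2 := hloc.deriv_deriv_nonpos (hdx x).continuousAt
    rw [funext fun y => (hdx y).deriv, deriv_sub_const] at h2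
    have h2' : pdxx w t x ≤ 0 := h2
    have h3 := hpde t ⟨ht₀.trans_le ht.1, htT⟩ x ⟨hx0, hxL⟩
    nlinarith [mul_nonneg hk.le (neg_nonneg.2 h2')]

/-- maximum principle: if −w_t − k w_xx ≤ 0 on (0,T)×(0,L) and
w_x(t,L) = 0, then the maximum of w over [0,T]×[0,L] is attained on the parabolic
half-boundary Γ_T = ([0,T]×{0}) ∪ ({T}×[0,L]). -/
theorem parabolic_maximum_principle (T L k : ℝ) (hT : 0 < T) (hL : 0 < L)
    (hk : 0 < k) (w : ℝ → ℝ → ℝ)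
    (hw : ContDiff ℝ (⊤ : ℕ∞) (uncurry w))
    (hpde : ∀ t ∈ Ioo (0:ℝ) T, ∀ x ∈ Ioo (0:ℝ) L,
      -(pdt w t x) - k * pdxx w t x ≤ 0)
    (hbdry : ∀ t ∈ Icc (0:ℝ) T, pdx w t L = 0) :
    ∀ t ∈ Icc (0:ℝ) T, ∀ x ∈ Icc (0:ℝ) L,
      w t x ≤ max (⨆ s : Icc (0:ℝ) T, w s.1 0) (⨆ y : Icc (0:ℝ) L, w T y.1) := by
  set M := max (⨆ s : Icc (0:ℝ) T, w s.1 0) (⨆ y : Icc (0:ℝ) L, w T y.1)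
  have hc : Continuous (uncurry w) := hw.continuous
  have hleft : ∀ s ∈ Icc (0:ℝ) T, w s 0 ≤ M := fun s hs => by
    have hcs : Continuous fun s => w s 0 := hc.comp (continuous_id.prodMk continuous_const)
    have hbdd := isCompact_Icc.bddAbove_image (K := Icc 0 T) hcs.continuousOn
    rw [image_eq_range] at hbdd
    exact (le_ciSup hbdd ⟨s, hs⟩).trans (le_max_left _ _)
  have htop : ∀ y ∈ Icc (0:ℝ) L, w T y ≤ M := fun y hy => by
    have hcy : Continuous (w T) := hc.comp (continuous_const.prodMk continuous_id)
    have hbdd := isCompact_Icc.bddAbove_image (K := Icc 0 L) hcy.continuousOn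
    rw [image_eq_range] at hbdd
    exact (le_ciSup hbdd ⟨y, hy⟩).trans (le_max_right _ _)
  intro t ht x hx
  have hpos : ∀ t ∈ Ioc (0:ℝ) T, w t x ≤ M := by
    intro t ht
    have key : ∀ ε > 0, w t x ≤ M + ε * (T + L) := by
      intro ε hε
      have hcv : Continuous fun p : ℝ × ℝ => uncurry w p + ε * (p.1 - p.2) := by fun_prop
      obtain ⟨⟨s, y⟩, ⟨hs, hy⟩, hmax⟩ := (isCompact_Icc.prod isCompact_Icc).exists_isMaxOn
        (s := Icc t T ×ˢ Icc 0 L) ⟨(t, x), ⟨le_rfl, ht.2⟩, hx⟩ hcv.continuousOn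
      have hmax' : ∀ s' ∈ Icc t T, ∀ y' ∈ Icc 0 L,
          w s' y' + ε * (s' - y') ≤ w s y + ε * (s - y) :=
        fun s' hs' y' hy' => hmax (show (s', y') ∈ Icc t T ×ˢ Icc 0 L from ⟨hs', hy'⟩)
      have hsy : w s y ≤ M := by
        rcases eq_zero_or_eq_of_perturbed_max hL hk ht.1 hε hw hpde hbdry hs hy hmax' with h | h
        · exact (show y = 0 from h) ▸ hleft s ⟨ht.1.le.trans hs.1, hs.2⟩
        · exact (show s = T from h) ▸ htop y hy
      have h := hmax' t ⟨le_rfl, ht.2⟩ x hx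
      have hdiff : (s - y) - (t - x) ≤ T + L := by linarith [hs.2, hy.1, hx.2, ht.1]
      nlinarith [mul_le_mul_of_nonneg_left hdiff hε.le]
    refine le_of_forall_pos_le_add fun δ hδ => ?_
    have h := key (δ / (T + L)) (by positivity)
    rwa [div_mul_cancel₀ _ (by positivity)] at h
  have hct : Continuous fun t => w t x := hc.comp (continuous_id.prodMk continuous_const)
  have hcl : closure (Ioc 0 T) ⊆ {t | w t x ≤ M} :=
    closure_minimal hpos (isClosed_le hct continuous_const)
  rw [closure_Ioc hT.ne] at hcl
  exact hcl ht
end
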